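/- arXiv:2210.12015 — 2 statements merged into one kernel-verified Lean document; each statement's English description precedes it below -/
import Mathlib

section
/- Let P ⊆ ℝ² be a finite set and let (c₁, ρ₁), …, (c_m, ρ_m) be pairs with cⱼ ∈ ℝ² and ρⱼ > 0 such that, for each j: (i) there exist two distinct points of P at distance exactly ρⱼ from cⱼ, (ii) no point of P lies in the open disk {x : dist(cⱼ, x) < ρⱼ}, and (iii) the sets ({x : dist(cⱼ, x) < ρⱼ}) \ interior(convexHull(P)), for j = 1,…,m, are pairwise disjoint. Then every finite set Q ⊆ ℝ² that blocks P from the exterior has cardinality at least m. -/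
noncomputable section

/-- The Euclidean plane. -/
abbrev Plane := EuclideanSpace ℝ (Fin 2)

/-- `Q` blocks `P`: for every pair of distinct points of `P` and every circle through them,
some point of `P ∪ Q` lies in the corresponding open disk. -/
def Blocks (P Q : Set Plane) : Prop :=
  ∀ p₁ ∈ P, ∀ p₂ ∈ P, p₁ ≠ p₂ →
    ∀ (c : Plane) (ρ : ℝ), 0 < ρ → dist c p₁ = ρ → dist c p₂ = ρ →
      ∃ x ∈ P ∪ Q, dist c x < ρ

/-- `Q` blocks `P` from the exterior: `Q` blocks `P` and no point of `Q` lies in the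
interior of the convex hull of `P`. -/
def BlocksFromExterior (P Q : Set Plane) : Prop :=
  Blocks P Q ∧ ∀ q ∈ Q, q ∉ interior (convexHull ℝ P)

theorem disjoint_blocking_areas_lower_bound (P : Set Plane) (hP : P.Finite)
    (m : ℕ) (c : Fin m → Plane) (ρ : Fin m → ℝ) (hρ : ∀ j, 0 < ρ j)
    (hthru : ∀ j, ∃ p ∈ P, ∃ q ∈ P, p ≠ q ∧ dist (c j) p = ρ j ∧ dist (c j) q = ρ j)
    (hempty : ∀ j, ∀ p ∈ P, ¬ dist (c j) p < ρ j)
    (hdisj : ∀ j j' : Fin m, j ≠ j' →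
      Disjoint (Metric.ball (c j) (ρ j) \ interior (convexHull ℝ P))
        (Metric.ball (c j') (ρ j') \ interior (convexHull ℝ P)))
    (Q : Set Plane) (hQ : Q.Finite) (hB : BlocksFromExterior P Q) :
    m ≤ Q.ncard := by
  have key : ∀ j, ∃ q ∈ Q, q ∈ Metric.ball (c j) (ρ j) \ interior (convexHull ℝ P) := by
    intro j
    obtain ⟨p, hp, p', hp', hne, hd, hd'⟩ := hthru j
    obtain ⟨x, hx | hx, hlt⟩ := hB.1 p hp p' hp' hne (c j) (ρ j) (hρ j) hd hd'
    · exact absurd hlt (hempty j x hx)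
    · exact ⟨x, hx, Metric.mem_ball'.2 hlt, hB.2 x hx⟩
  choose f hfQ hf using key
  have hinj : Function.Injective f := by
    intro i j hij
    by_contra hne
    exact Set.disjoint_left.1 (hdisj i j hne) (hf i) (hij ▸ hf j)
  calc m = (Set.range f).ncard := by
        rw [← Set.image_univ, Set.ncard_image_of_injective _ hinj, Set.ncard_univ, Nat.card_fin]
    _ ≤ Q.ncard := Set.ncard_le_ncard (Set.range_subset_iff.2 hfQ) hQ
end
end

section
/- If a, b, c, d are pairwise distinct positive real numbers, then the determinant of the 4×4 matrix with rows (1, 1, 1, 1), (a, b, c, d), (a³, b³, c³, d³), (a⁶, b⁶, c⁶, d⁶) is nonzero. -/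
/-- The generalized Vandermonde determinant with exponents `0, 1, 3, 6` is the Vandermonde product
times the Schur polynomial of the partition `(3, 1)`, here in the monomial symmetric basis. -/
theorem vandermonde_det_0136_eq {R : Type*} [CommRing R] (a b c d : R) :
    Matrix.det !![1, 1, 1, 1; a, b, c, d; a ^ 3, b ^ 3, c ^ 3, d ^ 3;
        a ^ 6, b ^ 6, c ^ 6, d ^ 6] =
      (b - a) * (c - a) * (d - a) * (c - b) * (d - b) * (d - c) *
        (a ^ 3 * (b + c + d) + b ^ 3 * (a + c + d) + c ^ 3 * (a + b + d) + d ^ 3 * (a + b + c) +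
          (a ^ 2 * b ^ 2 + a ^ 2 * c ^ 2 + a ^ 2 * d ^ 2 +
            b ^ 2 * c ^ 2 + b ^ 2 * d ^ 2 + c ^ 2 * d ^ 2) +
          2 * (a ^ 2 * (b * c + b * d + c * d) + b ^ 2 * (a * c + a * d + c * d) +
            c ^ 2 * (a * b + a * d + b * d) + d ^ 2 * (a * b + a * c + b * c)) +
          3 * (a * b * c * d)) := by
  simp [Matrix.det_succ_row_zero, Fin.sum_univ_succ, Fin.succAbove]
  ring

theorem vandermonde_det_0136_ne_zero (a b c d : ℝ)
    (ha : 0 < a) (hb : 0 < b) (hc : 0 < c) (hd : 0 < d)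
    (hab : a ≠ b) (hac : a ≠ c) (had : a ≠ d)
    (hbc : b ≠ c) (hbd : b ≠ d) (hcd : c ≠ d) :
    Matrix.det !![1, 1, 1, 1; a, b, c, d; a ^ 3, b ^ 3, c ^ 3, d ^ 3;
        a ^ 6, b ^ 6, c ^ 6, d ^ 6] ≠ 0 := by
  rw [vandermonde_det_0136_eq]
  refine mul_ne_zero ?_ (by positivity)
  simp only [ne_eq, mul_eq_zero, sub_eq_zero, not_or]
  exact ⟨⟨⟨⟨⟨hab.symm, hac.symm⟩, had.symm⟩, hbc.symm⟩, hbd.symm⟩, hcd.symm⟩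
end
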